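/- arXiv:2004.06595 — 2 statements merged into one kernel-verified Lean document; each statement's English description precedes it below -/
import Mathlib

section
/- Let Φ be a graph property, k a positive integer, and a the unique finitely supported rational coefficient function with #IndSub(Φ,k,G) = Σ_H a(H)·#Hom(H,G) for all graphs G. Then for every graph K on k vertices, a(K) = Σ_{H ∈ Φ_k} |Aut(H)|^{−1} · (−1)^{|E(K)|−|E(H)|} · #{K ⊇ H}, where Φ_k is the set of isomorphism classes of k-vertex graphs satisfying Φ, Aut(H) is the automorphism group of H, and #{K ⊇ H} is the number of edge sets A with E(H) ⊆ A ⊆ E(complete graph on V(H)) such that the graph (V(H), A) is isomorphic to K. -/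
open SimpleGraph

/-- A graph property: for each number of vertices `n`, a predicate on simple graphs
with vertex set `Fin n`. -/
abbrev GraphProperty := ∀ n : ℕ, SimpleGraph (Fin n) → Prop

/-- Invariance of a graph property under graph isomorphism. -/
def Invariant (Φ : GraphProperty) : Prop :=
  ∀ (n : ℕ) (G G' : SimpleGraph (Fin n)), Nonempty (G ≃g G') → (Φ n G ↔ Φ n G')

/-- `indSub Φ k G` is the number of `k`-element vertex subsets `S` of `G` such that the
induced subgraph `G[S]` satisfies `Φ`. -/
noncomputable def indSub (Φ : GraphProperty) (k : ℕ) {V : Type} [Fintype V]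
    (G : SimpleGraph V) : ℕ :=
  Nat.card {S : Finset V // S.card = k ∧
    ∃ e : Fin k ≃ (S : Set V), Φ k ((G.induce (S : Set V)).comap e)}

/-- Graphs on `Fin n` up to isomorphism. -/
instance graphSetoid (n : ℕ) : Setoid (SimpleGraph (Fin n)) where
  r G G' := Nonempty (G ≃g G')
  iseqv := by
    refine ⟨fun G => ⟨RelIso.refl _⟩, ?_, ?_⟩
    · rintro G G' ⟨e⟩; exact ⟨e.symm⟩
    · rintro G G' G'' ⟨e⟩ ⟨f⟩; exact ⟨e.trans f⟩

/-- Isomorphism classes of graphs on `n` vertices. -/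
abbrev GraphClass (n : ℕ) := Quotient (graphSetoid n)

/-- The number of graph homomorphisms from `H` to `G`. -/
noncomputable def homCount {n : ℕ} (H : SimpleGraph (Fin n)) {V : Type} [Fintype V]
    (G : SimpleGraph V) : ℕ :=
  Nat.card (H →g G)

/-- The number of homomorphisms from (a representative of) an isomorphism class to `G`. -/
noncomputable def classHomCount {n : ℕ} (c : GraphClass n) {V : Type} [Fintype V]
    (G : SimpleGraph V) : ℕ :=
  homCount c.out G

/-- The number of edges of a graph. -/
noncomputable def edgeCount {V : Type} (G : SimpleGraph V) : ℕ := Nat.card G.edgeSet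

/-- The number of automorphisms of a graph. -/
noncomputable def autCount {V : Type} (H : SimpleGraph V) : ℕ := Nat.card (H ≃g H)

/-- `extCount H K` is the number of edge supersets `A ⊇ E(H)` (within the complete graph
on the vertices of `H`) such that the resulting graph is isomorphic to `K`, encoded as
the number of graphs `L ≥ H` on the same vertex set with `L ≅ K`. -/
noncomputable def extCount {k : ℕ} (H K : SimpleGraph (Fin k)) : ℕ :=
  Nat.card {L : SimpleGraph (Fin k) // H ≤ L ∧ Nonempty (L ≃g K)}


open Classical in
/-- alternating sum over forbidden sets -/
lemma aux_alt {n k : ℕ} {T : Type} [Fintype T] (p : T → Fin k) (P : (Fin n → T) → Prop) :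
    ∑ U : Finset (Fin k), (-1 : ℚ) ^ U.card *
      (Nat.card {f : Fin n → T // P f ∧ ∀ i, p (f i) ∉ U} : ℚ)
    = (Nat.card {f : Fin n → T // P f ∧ Function.Surjective (p ∘ f)} : ℚ) := by
  have h1 : ∀ U : Finset (Fin k),
      (Nat.card {f : Fin n → T // P f ∧ ∀ i, p (f i) ∉ U} : ℚ)
      = ∑ f : Fin n → T, if P f ∧ ∀ i, p (f i) ∉ U then (1:ℚ) else 0 := by
    intro U
    rw [Nat.card_eq_fintype_card, Fintype.card_subtype, Finset.sum_boole]
  simp_rw [h1, Finset.mul_sum]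
  rw [Finset.sum_comm, Nat.card_eq_fintype_card, Fintype.card_subtype, ← Finset.sum_boole]
  refine Finset.sum_congr rfl fun f _ => ?_
  by_cases hP : P f
  swap
  · simp [hP]
  simp only [hP, true_and, mul_ite, mul_one, mul_zero]
  rw [← Finset.sum_filter]
  have h2 : (Finset.univ.filter fun U : Finset (Fin k) => ∀ i, p (f i) ∉ U)
      = ((Finset.univ.image (p ∘ f))ᶜ).powerset := by
    ext U
    simp only [Finset.mem_filter, Finset.mem_univ, true_and, Finset.mem_powerset]
    constructor
    · intro h x hx
      simp only [Finset.mem_compl, Finset.mem_image, Finset.mem_univ, true_and, not_exists]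
      rintro i rfl
      exact h i hx
    · intro h i hi
      have := h hi
      simp at this
  rw [h2]
  have h3 := Finset.sum_powerset_neg_one_pow_card (x := (Finset.univ.image (p ∘ f))ᶜ)
  have h4 : ∑ m ∈ ((Finset.univ.image (p ∘ f))ᶜ).powerset, (-1 : ℚ) ^ m.card
    = ((∑ m ∈ ((Finset.univ.image (p ∘ f))ᶜ).powerset, (-1 : ℤ) ^ m.card : ℤ) : ℚ) := by
    push_cast; rfl
  rw [h4, h3]
  have h5 : ((Finset.univ.image (p ∘ f))ᶜ = ∅) ↔ Function.Surjective (p ∘ f) := by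
    rw [Finset.compl_eq_empty_iff, ← Finset.coe_eq_univ, Finset.coe_image, Finset.coe_univ,
      Set.image_univ, Set.range_eq_univ]
  by_cases hs : Function.Surjective (p ∘ f)
  · rw [if_pos hs, if_pos (h5.2 hs)]; simp
  · rw [if_neg hs, if_neg (fun h => hs (h5.1 h))]; simp

/-- product count -/
lemma aux_prod {n k t : ℕ} (Q : (Fin n → Fin k) → Prop) :
    Nat.card {f : Fin n → Fin k × Fin t // Q (Prod.fst ∘ f)}
      = t ^ n * Nat.card {φ : Fin n → Fin k // Q φ} := by
  have e : {f : Fin n → Fin k × Fin t // Q (Prod.fst ∘ f)} ≃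
      (Fin n → Fin t) × {φ : Fin n → Fin k // Q φ} :=
    { toFun := fun f => (fun i => (f.1 i).2, ⟨Prod.fst ∘ f.1, f.2⟩)
      invFun := fun q => ⟨fun i => (q.2.1 i, q.1 i), q.2.2⟩
      left_inv := fun f => rfl
      right_inv := fun q => rfl }
  rw [Nat.card_congr e, Nat.card_prod]
  simp

lemma aux_indSub (Φ : GraphProperty) (hΦ : Invariant Φ) (k : ℕ) {V : Type} [Fintype V]
    (G : SimpleGraph V) :
    indSub Φ k G * k.factorial
      = Nat.card {f : Fin k → V // Function.Injective f ∧ Φ k (G.comap f)} := by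
  classical
  let X := {S : Finset V // S.card = k ∧
    ∃ e : Fin k ≃ (S : Set V), Φ k ((G.induce (S : Set V)).comap e)}
  let F : (Σ S : X, (Fin k ≃ (S.1 : Set V))) →
      {f : Fin k → V // Function.Injective f ∧ Φ k (G.comap f)} := fun q =>
    ⟨fun i => (q.2 i : V), fun i j h => q.2.injective (Subtype.ext h), by
      obtain ⟨⟨S, hS, e, he⟩, e'⟩ := q
      refine (hΦ k _ _ ⟨?_⟩).1 he
      exact ⟨e.trans e'.symm, by intro a b; simp⟩⟩
  have hF : Function.Bijective F := by
    constructor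
    · rintro ⟨⟨S, hS⟩, e⟩ ⟨⟨S', hS'⟩, e'⟩ h
      have h1 : ∀ i, (e i : V) = e' i := fun i => congrFun (congrArg Subtype.val h) i
      have : S = S' := by
        ext x
        constructor
        · intro hx
          have := h1 (e.symm ⟨x, hx⟩)
          simp only [Equiv.apply_symm_apply] at this
          rw [this]; exact (e' _).2
        · intro hx
          have := h1 (e'.symm ⟨x, hx⟩)
          simp only [Equiv.apply_symm_apply] at this
          rw [← this]; exact (e _).2
      subst this
      have : e = e' := Equiv.ext fun i => Subtype.ext (h1 i)
      subst this
      rfl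
    · rintro ⟨f, hf, hP⟩
      let S : Finset V := Finset.univ.image f
      let e : Fin k ≃ (S : Set V) := Equiv.ofBijective (fun i => ⟨f i, by simp [S]⟩) (by
        constructor
        · intro i j h; exact hf (congrArg Subtype.val h)
        · rintro ⟨x, hx⟩
          obtain ⟨i, rfl⟩ : ∃ i, f i = x := by simpa [S] using hx
          exact ⟨i, rfl⟩)
      exact ⟨⟨⟨S, by simp [S, Finset.card_image_of_injective _ hf], e, hP⟩, e⟩, rfl⟩
  rw [← Nat.card_eq_of_bijective F hF, Nat.card_sigma]
  have : ∀ S : X, Nat.card (Fin k ≃ (S.1 : Set V)) = k.factorial := by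
    rintro ⟨S, hS, e, he⟩
    rw [Nat.card_congr (Equiv.equivCongr (Equiv.refl (Fin k)) e.symm)]
    rw [Nat.card_eq_fintype_card]
    exact (Fintype.card_perm).trans (by simp)
  simp_rw [this]
  rw [Finset.sum_const, smul_eq_mul, Finset.card_univ, ← Nat.card_eq_fintype_card]
  rfl

/-- blow up with forbidden classes -/
def blow {k : ℕ} (F : SimpleGraph (Fin k)) (t : ℕ) (U : Finset (Fin k)) :
    SimpleGraph {p : Fin k × Fin t // p.1 ∉ U} := F.comap (fun p => p.1.1)

lemma aux_hom {n k : ℕ} (H : SimpleGraph (Fin n)) (F : SimpleGraph (Fin k)) (t : ℕ) :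
    ∑ U : Finset (Fin k), (-1 : ℚ) ^ U.card * (homCount H (blow F t U) : ℚ)
    = (t : ℚ) ^ n *
      (Nat.card {φ : Fin n → Fin k // H ≤ F.comap φ ∧ Function.Surjective φ} : ℚ) := by
  have h := aux_prod (t := t) (fun φ : Fin n → Fin k => H ≤ F.comap φ ∧ Function.Surjective φ)
  have h2 := aux_alt (Prod.fst : Fin k × Fin t → Fin k)
    (fun f : Fin n → _ => H ≤ F.comap (Prod.fst ∘ f))
  rw [h] at h2
  push_cast at h2
  rw [← h2]
  refine Finset.sum_congr rfl fun U _ => ?_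
  congr 2
  refine Nat.card_congr ?_
  exact
    { toFun := fun g => ⟨fun i => (g i).1, fun a b hab => g.map_rel hab, fun i => (g i).2⟩
      invFun := fun f => ⟨fun i => ⟨f.1 i, f.2.2 i⟩, fun {a b} hab => f.2.1 hab⟩
      left_inv := fun g => rfl
      right_inv := fun f => rfl }

open Classical in
lemma aux_ind (Φ : GraphProperty) (hΦ : Invariant Φ) {k : ℕ} (F : SimpleGraph (Fin k)) (t : ℕ) :
    ∑ U : Finset (Fin k), (-1 : ℚ) ^ U.card * (indSub Φ k (blow F t U) : ℚ)
    = (t : ℚ) ^ k * (if Φ k F then 1 else 0) := by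
  have h := aux_prod (t := t) (fun φ : Fin k → Fin k => Φ k (F.comap φ) ∧ Function.Surjective φ)
  have h2 := aux_alt (Prod.fst : Fin k × Fin t → Fin k)
    (fun f : Fin k → _ => Function.Injective f ∧ Φ k (F.comap (Prod.fst ∘ f)))
  have h3 : Nat.card {f : Fin k → Fin k × Fin t //
      (Function.Injective f ∧ Φ k (F.comap (Prod.fst ∘ f))) ∧ Function.Surjective (Prod.fst ∘ f)}
    = Nat.card {f : Fin k → Fin k × Fin t //
       Φ k (F.comap (Prod.fst ∘ f)) ∧ Function.Surjective (Prod.fst ∘ f)} := by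
    refine Nat.card_congr (Equiv.subtypeEquivRight fun f => ?_)
    constructor
    · rintro ⟨⟨_, h⟩, h'⟩; exact ⟨h, h'⟩
    · rintro ⟨h, h'⟩
      exact ⟨⟨(Finite.injective_iff_surjective.2 h').of_comp, h⟩, h'⟩
  have h4 : Nat.card {φ : Fin k → Fin k // Φ k (F.comap φ) ∧ Function.Surjective φ}
      = if Φ k F then k.factorial else 0 := by
    have key : ∀ φ : Fin k → Fin k, Function.Surjective φ → (Φ k (F.comap φ) ↔ Φ k F) := by
      intro φ hφ
      refine hΦ k _ _ ⟨⟨Equiv.ofBijective φ ⟨Finite.injective_iff_surjective.2 hφ, hφ⟩, ?_⟩⟩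
      intro a b; rfl
    split_ifs with hF
    · have e : {φ : Fin k → Fin k // Φ k (F.comap φ) ∧ Function.Surjective φ} ≃
          Equiv.Perm (Fin k) :=
        { toFun := fun φ => Equiv.ofBijective φ.1
            ⟨Finite.injective_iff_surjective.2 φ.2.2, φ.2.2⟩
          invFun := fun σ => ⟨σ, (key _ σ.surjective).2 hF, σ.surjective⟩
          left_inv := fun φ => rfl
          right_inv := fun σ => Equiv.ext fun _ => rfl }
      rw [Nat.card_congr e, Nat.card_eq_fintype_card, Fintype.card_perm, Fintype.card_fin]
    · rw [Nat.card_eq_zero]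
      left
      exact ⟨fun φ => hF ((key _ φ.2.2).1 φ.2.1)⟩
  rw [h3, h, h4] at h2
  have hk : (k.factorial : ℚ) ≠ 0 := by exact_mod_cast k.factorial_ne_zero
  apply mul_right_cancel₀ hk
  have h5 : (t : ℚ) ^ k * (if Φ k F then 1 else 0) * (k.factorial : ℚ)
     = ((t ^ k * (if Φ k F then k.factorial else 0) : ℕ) : ℚ) := by
    split_ifs <;> simp
  rw [h5, ← h2, Finset.sum_mul]
  refine Finset.sum_congr rfl fun U _ => ?_
  rw [mul_assoc]
  congr 1
  rw [← Nat.cast_mul, aux_indSub Φ hΦ]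
  congr 1
  refine Nat.card_congr ?_
  exact
    { toFun := fun g => ⟨fun i => (g.1 i).1,
        ⟨fun i j h => g.2.1 (Subtype.ext h), g.2.2⟩, fun i => (g.1 i).2⟩
      invFun := fun f => ⟨fun i => ⟨f.1 i, f.2.2 i⟩,
        fun i j h => f.2.1.1 (congrArg Subtype.val h), f.2.1.2⟩
      left_inv := fun g => rfl
      right_inv := fun f => rfl }

lemma aux_coef (Φ : GraphProperty) (hΦ : Invariant Φ) (k : ℕ)
    (a : (Σ n, GraphClass n) → ℚ) (ha : (Function.support a).Finite)
    (heq : ∀ (V : Type) [Fintype V], ∀ G : SimpleGraph V,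
      (indSub Φ k G : ℚ) = ∑ᶠ c : Σ n, GraphClass n, a c * (classHomCount c.2 G : ℚ))
    (F : SimpleGraph (Fin k)) [Fintype (GraphClass k)] [Decidable (Φ k F)] :
    (if Φ k F then (1 : ℚ) else 0) = ∑ c : GraphClass k, a ⟨k, c⟩ *
      (Nat.card {φ : Fin k → Fin k // c.out ≤ F.comap φ ∧ Function.Surjective φ} : ℚ) := by
  classical
  let b : (Σ n, GraphClass n) → ℚ := fun c =>
    (Nat.card {φ : Fin c.1 → Fin k // c.2.out ≤ F.comap φ ∧ Function.Surjective φ} : ℚ)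
  have h1 : ∀ t : ℕ, (t : ℚ) ^ k * (if Φ k F then 1 else 0)
      = ∑ c ∈ ha.toFinset, a c * b c * (t : ℚ) ^ c.1 := by
    intro t
    have h := aux_ind Φ hΦ F t
    have h2 : ∀ U, (indSub Φ k (blow F t U) : ℚ)
        = ∑ c ∈ ha.toFinset, a c * (classHomCount c.2 (blow F t U) : ℚ) := by
      intro U
      rw [heq]
      apply finsum_eq_sum_of_support_subset
      intro c hc
      simp only [Function.mem_support, Set.Finite.coe_toFinset] at hc ⊢
      exact left_ne_zero_of_mul hc
    simp_rw [h2, Finset.mul_sum] at h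
    rw [Finset.sum_comm] at h
    have h0 : (t : ℚ) ^ k * (if Φ k F then 1 else 0)
      = ∑ y ∈ ha.toFinset, ∑ x, (-1 : ℚ) ^ x.card * (a y * (classHomCount y.2 (blow F t x) : ℚ)) := by
      rw [h]; congr
    rw [h0]
    refine Finset.sum_congr rfl fun c _ => ?_
    have h3 := aux_hom c.2.out F t
    calc _ = a c * ∑ U : Finset (Fin k), (-1 : ℚ) ^ U.card
            * (homCount c.2.out (blow F t U) : ℚ) := by
          rw [Finset.mul_sum]
          refine Finset.sum_congr rfl fun U _ => ?_
          rw [mul_left_comm]; rfl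
      _ = _ := by rw [h3]; simp only [b]; ring
  have h2 : Polynomial.C (if Φ k F then (1:ℚ) else 0) * Polynomial.X ^ k
      = ∑ c ∈ ha.toFinset, Polynomial.C (a c * b c) * Polynomial.X ^ c.1 := by
    apply Polynomial.eq_of_infinite_eval_eq
    refine Set.Infinite.mono ?_ (Set.infinite_range_of_injective (Nat.cast_injective (R := ℚ)))
    rintro _ ⟨t, rfl⟩
    simp only [Set.mem_ofPred_eq, Polynomial.eval_finsetSum, Polynomial.eval_mul,
      Polynomial.eval_C, Polynomial.eval_pow, Polynomial.eval_X]
    rw [← h1, mul_comm]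
  have h3 := congrArg (fun p => Polynomial.coeff p k) h2
  simp only [Polynomial.finsetSum_coeff, Polynomial.coeff_C_mul, Polynomial.coeff_X_pow,
    if_true, mul_one, mul_ite, mul_zero] at h3
  rw [h3, ← Finset.sum_filter]
  symm
  have h4 : ∑ c : GraphClass k, a ⟨k, c⟩ * b ⟨k, c⟩
     = ∑ c ∈ Finset.univ.map (Function.Embedding.sigmaMk (β := GraphClass) k), a c * b c := by
    rw [Finset.sum_map]; rfl
  refine h4.trans (Eq.symm ?_)
  apply Finset.sum_subset
  · rintro ⟨n, c⟩ hc
    obtain rfl : k = n := (Finset.mem_filter.1 hc).2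
    simp
  · rintro ⟨n, c⟩ hc hc'
    simp only [Finset.mem_map, Finset.mem_univ, true_and] at hc
    obtain ⟨c', hc⟩ := hc
    have hn : k = n := congrArg Sigma.fst hc
    simp only [Finset.mem_filter, Set.Finite.mem_toFinset, Function.mem_support, hn, and_true,
      not_not] at hc'
    rw [hc', zero_mul]

lemma autCount_congr {k : ℕ} {H L : SimpleGraph (Fin k)} (e : L ≃g H) :
    autCount L = autCount H :=
  Nat.card_congr
    { toFun := fun f => (e.symm.trans f).trans e
      invFun := fun f => (e.trans f).trans e.symm
      left_inv := fun f => by ext x; simp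
      right_inv := fun f => by ext x; simp }

lemma isoCount_eq {k : ℕ} {H L : SimpleGraph (Fin k)} (e : L ≃g H) :
    Nat.card (L ≃g H) = autCount H :=
  Nat.card_congr
    { toFun := fun f => e.symm.trans f
      invFun := fun f => e.trans f
      left_inv := fun f => by ext x; simp
      right_inv := fun f => by ext x; simp }

lemma edgeCount_congr {k : ℕ} {H L : SimpleGraph (Fin k)} (e : L ≃g H) :
    edgeCount L = edgeCount H := Nat.card_congr e.mapEdgeSet

lemma autCount_ne {k : ℕ} (H : SimpleGraph (Fin k)) : (autCount H : ℚ) ≠ 0 := by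
  have : Finite (H ≃g H) := Finite.of_injective (fun f => (f : Fin k → Fin k))
    DFunLike.coe_injective
  have : 0 < autCount H := Nat.card_pos_iff.2 ⟨⟨RelIso.refl _⟩, this⟩
  exact_mod_cast this.ne'

open Classical in
lemma aux_orbit {k : ℕ} (H : SimpleGraph (Fin k)) (R : SimpleGraph (Fin k) → Prop) :
    (Nat.card {σ : Equiv.Perm (Fin k) // R (H.comap σ)} : ℚ)
      = autCount H * (Nat.card {L : SimpleGraph (Fin k) // R L ∧ Nonempty (L ≃g H)} : ℚ) := by
  let e : {σ : Equiv.Perm (Fin k) // R (H.comap σ)} ≃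
      Σ L : {L : SimpleGraph (Fin k) // R L ∧ Nonempty (L ≃g H)}, (L.1 ≃g H) :=
    { toFun := fun σ => ⟨⟨H.comap σ.1, σ.2, ⟨⟨σ.1, by intro a b; rfl⟩⟩⟩, ⟨σ.1, by intro a b; rfl⟩⟩
      invFun := fun q => ⟨q.2.toEquiv, by
        have : H.comap q.2.toEquiv = q.1.1 := by
          ext x y; exact q.2.map_rel_iff
        rw [this]; exact q.1.2.1⟩
      left_inv := fun σ => rfl
      right_inv := by
        rintro ⟨⟨L, hL⟩, ⟨f, hf⟩⟩
        have : H.comap f = L := by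
          ext x y; exact hf
        subst this
        rfl }
  rw [Nat.card_congr e]
  let _ : Fintype {L : SimpleGraph (Fin k) // R L ∧ Nonempty (L ≃g H)} := Fintype.ofFinite _
  have hfin : ∀ L : {L : SimpleGraph (Fin k) // R L ∧ Nonempty (L ≃g H)}, Finite (L.1 ≃g H) :=
    fun L => Finite.of_injective (fun f => (f : Fin k → Fin k)) DFunLike.coe_injective
  rw [Nat.card_sigma, Finset.sum_congr rfl (fun L _ => isoCount_eq L.2.2.some)]
  simp [mul_comm, Nat.card_eq_fintype_card]

/-- counting permutations embedding `H` into `F` -/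
lemma aux_perm1 {k : ℕ} (H F : SimpleGraph (Fin k)) :
    (Nat.card {φ : Fin k → Fin k // H ≤ F.comap φ ∧ Function.Surjective φ} : ℚ)
      = autCount H * (Nat.card {L : SimpleGraph (Fin k) // L ≤ F ∧ Nonempty (L ≃g H)} : ℚ) := by
  rw [← aux_orbit H (fun L => L ≤ F)]
  congr 1
  refine Nat.card_congr ?_
  exact
    { toFun := fun φ => ⟨(Equiv.ofBijective φ.1
            ⟨Finite.injective_iff_surjective.2 φ.2.2, φ.2.2⟩).symm, by
          intro x y hxy
          have := φ.2.1 hxy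
          simp only [SimpleGraph.comap_adj] at this
          have hs := Equiv.ofBijective_apply_symm_apply φ.1
            ⟨Finite.injective_iff_surjective.2 φ.2.2, φ.2.2⟩
          rwa [hs, hs] at this⟩
      invFun := fun σ => ⟨σ.1.symm, by
          intro x y hxy
          apply σ.2
          simpa using hxy, σ.1.symm.surjective⟩
      left_inv := fun φ => rfl
      right_inv := fun σ => by
        apply Subtype.ext; ext x; simp }

lemma aux_perm2 {k : ℕ} (H F : SimpleGraph (Fin k)) :
    (Nat.card {φ : Fin k → Fin k // H ≤ F.comap φ ∧ Function.Surjective φ} : ℚ)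
      = autCount F * (extCount H F : ℚ) := by
  rw [extCount, ← aux_orbit F (fun L => H ≤ L)]
  congr 1
  refine Nat.card_congr ?_
  exact
    { toFun := fun φ => ⟨Equiv.ofBijective φ.1
            ⟨Finite.injective_iff_surjective.2 φ.2.2, φ.2.2⟩, φ.2.1⟩
      invFun := fun σ => ⟨σ.1, σ.2, σ.1.surjective⟩
      left_inv := fun φ => rfl
      right_inv := fun σ => by
        apply Subtype.ext; ext x; rfl }

lemma edgeCount_sup {k : ℕ} (H : SimpleGraph (Fin k)) {x y : Fin k} (hxy : x ≠ y)
    (h : ¬ H.Adj x y) : edgeCount (H ⊔ edge x y) = edgeCount H + 1 := by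
  classical
  have := card_edgeFinset_sup_edge (G := H) h hxy
  rw [edgeCount, edgeCount, Nat.card_eq_fintype_card, Nat.card_eq_fintype_card,
    ← SimpleGraph.edgeFinset_card, ← SimpleGraph.edgeFinset_card]
  convert this

open Classical in
lemma aux_mobius {k : ℕ} (L K : SimpleGraph (Fin k)) :
    ∑ H : SimpleGraph (Fin k), (if L ≤ H ∧ H ≤ K then (-1 : ℚ) ^ edgeCount H else 0)
      = if L = K then (-1 : ℚ) ^ edgeCount K else 0 := by
  by_cases hLK : L = K
  · subst hLK
    rw [if_pos rfl, Finset.sum_eq_single L]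
    · simp
    · intro H _ hH
      rw [if_neg]
      rintro ⟨h1, h2⟩
      exact hH (le_antisymm h2 h1)
    · simp
  rw [if_neg hLK]
  by_cases hle : L ≤ K
  swap
  · refine Finset.sum_eq_zero fun H _ => if_neg ?_
    rintro ⟨h1, h2⟩; exact hle (h1.trans h2)
  have hnle : ¬ K ≤ L := fun h => hLK (le_antisymm hle h)
  obtain ⟨x, y, hK, hL⟩ : ∃ x y, K.Adj x y ∧ ¬ L.Adj x y := by
    by_contra hcon
    push Not at hcon
    exact hnle fun x y h => hcon x y h
  have hxy : x ≠ y := hK.ne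
  have hE : edge x y ≤ K := (edge_le_iff K).2 (Or.inr hK)
  rw [← Finset.sum_filter]
  have hcard : ∀ H : SimpleGraph (Fin k),
      (-1 : ℚ) ^ edgeCount H + (-1 : ℚ) ^ edgeCount (symmDiff H (edge x y)) = 0 := by
    have base : ∀ H : SimpleGraph (Fin k), ¬ H.Adj x y → symmDiff H (edge x y) = H ⊔ edge x y := by
      intro H hH
      apply Disjoint.symmDiff_eq_sup
      rw [disjoint_iff]
      ext u v
      simp only [inf_adj, bot_adj, iff_false, not_and, edge_adj]
      rintro h (⟨h1, h2⟩ | ⟨h1, h2⟩) _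
      · rw [h1, h2] at h; exact hH h
      · rw [h1, h2] at h; exact hH h.symm
    intro H
    by_cases hH : H.Adj x y
    · have hn : ¬ (symmDiff H (edge x y)).Adj x y := by
        simp [symmDiff, hH, edge_adj, hxy]
      have h1 := base _ hn
      rw [symmDiff_symmDiff_cancel_right] at h1
      have h2 := edgeCount_sup _ hxy hn
      rw [← h1] at h2
      rw [h2, pow_succ]; ring
    · rw [base H hH, edgeCount_sup _ hxy hH, pow_succ]; ring
  refine Finset.sum_involution (fun H _ => symmDiff H (edge x y)) (fun H _ => hcard H)
    ?_ ?_ (fun H _ => symmDiff_symmDiff_cancel_right _ _)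
  · intro H _ hne heq
    have := hcard H
    rw [heq] at this
    apply hne; linarith
  · intro H hH
    simp only [Finset.mem_filter, Finset.mem_univ, true_and] at hH ⊢
    constructor
    · intro u v huv
      have h1 := hH.1 huv
      simp only [symmDiff, sup_adj, sdiff_adj]
      left
      refine ⟨h1, ?_⟩
      rw [edge_adj]
      rintro ⟨⟨rfl, rfl⟩ | ⟨rfl, rfl⟩, _⟩
      · exact hL huv
      · exact hL huv.symm
    · exact symmDiff_le_sup.trans (sup_le hH.2 hE)

lemma sign_eq (m n : ℕ) : (-1 : ℚ) ^ ((m : ℤ) - (n : ℤ)) = (-1) ^ m * (-1) ^ n := by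
  rw [zpow_sub₀ (by norm_num), zpow_natCast, zpow_natCast, div_eq_mul_inv, ← inv_pow]
  norm_num

open Classical in
lemma class_sum {k : ℕ} [Fintype (GraphClass k)] (K : SimpleGraph (Fin k))
    (g : GraphClass k → ℚ) :
    ∑ c : GraphClass k, g c *
      (Nat.card {L : SimpleGraph (Fin k) // L ≤ K ∧ Nonempty (L ≃g c.out)} : ℚ)
    = ∑ L : SimpleGraph (Fin k), if L ≤ K then g ⟦L⟧ else 0 := by
  rw [← Finset.sum_fiberwise Finset.univ (fun L : SimpleGraph (Fin k) => (⟦L⟧ : GraphClass k))]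
  refine Finset.sum_congr rfl fun c _ => ?_
  rw [Nat.card_eq_fintype_card, Fintype.card_subtype, ← Finset.sum_filter, Finset.filter_filter]
  have : (Finset.univ.filter fun L : SimpleGraph (Fin k) => L ≤ K ∧ Nonempty (L ≃g c.out))
     = Finset.univ.filter fun L : SimpleGraph (Fin k) => (⟦L⟧ : GraphClass k) = c ∧ L ≤ K := by
    ext L
    simp only [Finset.mem_filter, Finset.mem_univ, true_and]
    rw [and_comm]
    refine and_congr_left fun _ => ?_
    exact (Quotient.mk_eq_iff_out (s := graphSetoid k)).symm
  rw [this, Finset.sum_congr rfl (g := fun _ => g c), Finset.sum_const, nsmul_eq_mul, mul_comm]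
  intro L hL
  rw [(Finset.mem_filter.1 hL).2.1]

theorem stmt4 (Φ : GraphProperty) (hΦ : Invariant Φ) (k : ℕ) (hk : 0 < k)
    (a : (Σ n, GraphClass n) → ℚ) (ha : (Function.support a).Finite)
    (heq : ∀ (V : Type) [Fintype V], ∀ G : SimpleGraph V,
      (indSub Φ k G : ℚ) = ∑ᶠ c : Σ n, GraphClass n, a c * (classHomCount c.2 G : ℚ))
    (K : SimpleGraph (Fin k)) :
    a ⟨k, ⟦K⟧⟩ = ∑ᶠ (c : GraphClass k) (_ : Φ k c.out),
      (autCount c.out : ℚ)⁻¹ *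
        (-1 : ℚ) ^ ((edgeCount K : ℤ) - (edgeCount c.out : ℤ)) *
        (extCount c.out K : ℚ) := by
  classical
  let _ : Fintype (GraphClass k) := Fintype.ofFinite _
  have hout : ∀ L : SimpleGraph (Fin k), Nonempty ((⟦L⟧ : GraphClass k).out ≃g L) :=
    fun L => Quotient.mk_out (s := graphSetoid k) L
  -- the expansion of the indicator
  have hind : ∀ F : SimpleGraph (Fin k), (if Φ k F then (1 : ℚ) else 0)
      = ∑ L : SimpleGraph (Fin k), if L ≤ F then a ⟨k, ⟦L⟧⟩ * autCount L else 0 := by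
    intro F
    rw [aux_coef Φ hΦ k a ha heq F]
    simp_rw [aux_perm1, ← mul_assoc]
    rw [class_sum F (fun c => a ⟨k, c⟩ * (autCount c.out : ℚ))]
    refine Finset.sum_congr rfl fun L _ => ?_
    rw [autCount_congr (hout L).some]
  apply mul_right_cancel₀ (autCount_ne K)
  rw [finsum_eq_sum_of_fintype]
  simp_rw [finsum_eq_if]
  -- rewrite the right-hand side
  have hR : (∑ c : GraphClass k, if Φ k c.out then (autCount c.out : ℚ)⁻¹ *
        (-1 : ℚ) ^ ((edgeCount K : ℤ) - (edgeCount c.out : ℤ)) *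
        (extCount c.out K : ℚ) else 0) * (autCount K : ℚ)
      = ∑ H : SimpleGraph (Fin k), if H ≤ K then
          (-1 : ℚ) ^ edgeCount K * ((-1) ^ edgeCount H * (if Φ k H then 1 else 0)) else 0 := by
    have h1 := class_sum K (fun c => (-1 : ℚ) ^ edgeCount K *
      ((-1) ^ edgeCount c.out * (if Φ k c.out then 1 else 0)))
    have h2 : ∀ L : SimpleGraph (Fin k), (Φ k (⟦L⟧ : GraphClass k).out ↔ Φ k L) :=
      fun L => hΦ k _ _ (hout L)
    have h3 : ∀ L : SimpleGraph (Fin k), edgeCount (⟦L⟧ : GraphClass k).out = edgeCount L :=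
      fun L => edgeCount_congr (hout L).some
    simp only [h2, h3] at h1
    rw [← h1, Finset.sum_mul]
    refine Finset.sum_congr rfl fun c _ => ?_
    by_cases hc : Φ k c.out
    · simp only [hc, if_true, mul_one]
      have h4 := (aux_perm2 c.out K).symm.trans (aux_perm1 c.out K)
      have h5 := autCount_ne c.out
      rw [sign_eq]
      field_simp
      linear_combination h4
    · simp [hc]
  rw [hR]
  simp_rw [hind]
  have hswap : ∀ H : SimpleGraph (Fin k), (if H ≤ K then
      (-1 : ℚ) ^ edgeCount K * ((-1) ^ edgeCount H *
        ∑ L : SimpleGraph (Fin k), if L ≤ H then a ⟨k, ⟦L⟧⟩ * (autCount L : ℚ) else 0) else 0)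
      = ∑ L : SimpleGraph (Fin k), (-1 : ℚ) ^ edgeCount K * (a ⟨k, ⟦L⟧⟩ * (autCount L : ℚ)) *
          (if L ≤ H ∧ H ≤ K then (-1 : ℚ) ^ edgeCount H else 0) := by
    intro H
    by_cases hH : H ≤ K
    · simp only [hH, if_true, and_true, Finset.mul_sum]
      refine Finset.sum_congr rfl fun L _ => ?_
      split_ifs <;> ring
    · simp [hH]
  simp_rw [hswap]
  rw [Finset.sum_comm]
  simp_rw [← Finset.mul_sum, aux_mobius]
  rw [Finset.sum_eq_single K]
  · rw [if_pos rfl]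
    have : (-1 : ℚ) ^ edgeCount K * (-1) ^ edgeCount K = 1 := by
      rw [← mul_pow]; norm_num
    linear_combination (-(a ⟨k, ⟦K⟧⟩ * (autCount K : ℚ))) * this
  · intro L _ hL
    rw [if_neg hL, mul_zero]
  · simp
end

section
/- Let Φ be a graph property, k a positive integer, and let w be the Hamming weight of the f-vector f^{Φ,k}. Suppose Φ is not trivially false on k-vertex graphs (i.e., some graph on k vertices satisfies Φ). Then the unique finitely supported function a from isomorphism classes of finite simple graphs to ℚ satisfying #IndSub(Φ,k,G) = Σ_H a(H)·#Hom(H,G) for all graphs G has the property that there exists a graph K on k vertices with at least k(k−1)/2 − w + 1 edges such that a(K) ≠ 0. -/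
open SimpleGraph

/-- The `i`-th entry of the f-vector of `Φ` and `k`. -/
noncomputable def fVec (Φ : GraphProperty) (k i : ℕ) : ℕ :=
  Nat.card {L : SimpleGraph (Fin k) // edgeCount L = i ∧ Φ k L}

/-- The Hamming weight of the f-vector `f^{Φ,k}`. -/
noncomputable def hammingWeight (Φ : GraphProperty) (k : ℕ) : ℕ :=
  ((Finset.range (k * (k - 1) / 2 + 1)).filter (fun i => fVec Φ k i ≠ 0)).card


abbrev GC := Σ n, GraphClass n

noncomputable def hev (a : GC →₀ ℚ) {V : Type} [Fintype V] (G : SimpleGraph V) : ℚ :=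
  a.sum fun c x => x * (classHomCount c.2 G : ℚ)

lemma hev_add (a b : GC →₀ ℚ) {V : Type} [Fintype V] (G : SimpleGraph V) :
    hev (a + b) G = hev a G + hev b G := by
  unfold hev
  rw [Finsupp.sum_add_index'] <;> intros <;> ring

lemma hev_smul (r : ℚ) (b : GC →₀ ℚ) {V : Type} [Fintype V] (G : SimpleGraph V) :
    hev (r • b) G = r * hev b G := by
  unfold hev
  rw [Finsupp.sum_smul_index' (by simp), Finsupp.mul_sum]
  simp [mul_assoc]

lemma hev_sub (a b : GC →₀ ℚ) {V : Type} [Fintype V] (G : SimpleGraph V) :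
    hev (a - b) G = hev a G - hev b G := by
  have : a - b = a + (-1 : ℚ) • b := by simp [sub_eq_add_neg]
  rw [this, hev_add, hev_smul]; ring

lemma hev_sum {ι : Type*} (s : Finset ι) (a : ι → GC →₀ ℚ) {V : Type} [Fintype V]
    (G : SimpleGraph V) : hev (∑ i ∈ s, a i) G = ∑ i ∈ s, hev (a i) G := by
  classical
  induction s using Finset.induction_on with
  | empty => simp [hev]
  | insert i s hi ih => rw [Finset.sum_insert hi, Finset.sum_insert hi, hev_add, ih]

lemma classHomCount_mk {n : ℕ} (H : SimpleGraph (Fin n)) {V : Type} [Fintype V]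
    (G : SimpleGraph V) : classHomCount (⟦H⟧ : GraphClass n) G = homCount H G := by
  unfold classHomCount homCount
  obtain ⟨e⟩ : Nonempty ((⟦H⟧ : GraphClass n).out ≃g H) := Quotient.mk_out H
  refine Nat.card_congr ⟨fun f => f.comp e.symm.toHom, fun f => f.comp e.toHom, ?_, ?_⟩
  · intro f; ext x; simp
  · intro f; ext x; simp

lemma hev_single {n : ℕ} (H : SimpleGraph (Fin n)) {V : Type} [Fintype V]
    (G : SimpleGraph V) : hev (Finsupp.single ⟨n, ⟦H⟧⟩ 1) G = (homCount H G : ℚ) := by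
  unfold hev
  rw [Finsupp.sum_single_index (by simp)]
  simp [classHomCount_mk]

/-- homomorphisms whose image lies in a subgraph -/
def homLe {n : ℕ} (H : SimpleGraph (Fin n)) {V : Type} {F : SimpleGraph V} (F' : F.Subgraph) :
    {f : H →g F // (⊤ : H.Subgraph).map f ≤ F'} ≃ (H →g F'.coe) where
  toFun f := ⟨fun x => ⟨f.1 x, f.2.1 ⟨x, trivial, rfl⟩⟩,
    fun {x y} h => f.2.2 ⟨x, y, h, rfl, rfl⟩⟩
  invFun g := ⟨F'.hom.comp g, by
    constructor
    · rintro _ ⟨x, -, rfl⟩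
      exact (g x).2
    · rintro _ _ ⟨x, y, h, rfl, rfl⟩
      exact g.map_rel h⟩
  left_inv f := by ext x; rfl
  right_inv g := by ext x; rfl

lemma hev_inj (a : GC →₀ ℚ)
    (h : ∀ (V : Type) [Fintype V] (G : SimpleGraph V), hev a G = 0) : a = 0 := by
  classical
  by_contra hne
  obtain ⟨c0, hc0, hmax⟩ := Finset.exists_max_image a.support (fun c => c.1)
    (Finsupp.support_nonempty_iff.mpr hne)
  set F := c0.2.out with hF
  let cnt : GC → F.Subgraph → ℕ := fun c F' =>
    Nat.card {f : c.2.out →g F // (⊤ : (c.2.out).Subgraph).map f = F'}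
  let N : F.Subgraph → ℚ := fun F' => a.sum fun c x => x * (cnt c F' : ℚ)
  let _ : Fintype F.Subgraph := Fintype.ofFinite _
  have hcnt : ∀ c F', classHomCount c.2 (F' : F.Subgraph).coe
      = ∑ F'' ∈ Finset.univ.filter (· ≤ F'), cnt c F'' := by
    intro c F'
    unfold classHomCount homCount
    rw [← Nat.card_congr (homLe c.2.out F')]
    rw [← Nat.card_congr (Equiv.sigmaFiberEquiv
      (fun f : {f : c.2.out →g F // (⊤ : (c.2.out).Subgraph).map f ≤ F'} =>
        (⊤ : (c.2.out).Subgraph).map f.1)), Nat.card_sigma, Finset.sum_filter]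
    refine Finset.sum_congr rfl fun F'' _ => ?_
    split_ifs with hle
    · refine Nat.card_congr ⟨fun f => ⟨f.1.1, f.2⟩, fun f => ⟨⟨f.1, f.2.le.trans hle⟩, f.2⟩, ?_, ?_⟩
      · intro f; rfl
      · intro f; rfl
    · rw [Nat.card_eq_zero]
      left
      exact ⟨fun f => hle (f.2 ▸ f.1.2)⟩
  have hsum : ∀ F', ∑ F'' ∈ Finset.univ.filter (· ≤ F'), N F'' = 0 := by
    intro F'
    have := h _ F'.coe
    rw [← this]
    unfold hev
    simp only [N, Finsupp.sum]
    rw [Finset.sum_comm]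
    refine Finset.sum_congr rfl fun c _ => ?_
    rw [hcnt, Nat.cast_sum, Finset.mul_sum]
  have hN : ∀ F', N F' = 0 := by
    intro F'
    induction F' using WellFoundedLT.induction with
    | ind F' ih =>
      have := hsum F'
      rw [Finset.sum_eq_single F'] at this
      · exact this
      · intro b hb hbne
        exact ih b (lt_of_le_of_ne (by simpa using hb) hbne)
      · intro hh; simp at hh
  have h1 := hN ⊤
  simp only [N, Finsupp.sum] at h1
  rw [Finset.sum_eq_single c0] at h1
  · have hpos : cnt c0 ⊤ ≠ 0 := by
      simp only [cnt]
      rw [Nat.card_ne_zero]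
      refine ⟨⟨⟨Hom.id, ?_⟩⟩, inferInstance⟩
      simp
    simp only [mul_eq_zero, Nat.cast_eq_zero] at h1
    rcases h1 with h1 | h1
    · exact (Finsupp.mem_support_iff.mp hc0) h1
    · exact hpos h1
  · intro c hc hcne
    suffices cnt c ⊤ = 0 by simp [this]
    simp only [cnt]
    rw [Nat.card_eq_zero]
    left
    refine ⟨fun ⟨f, hf⟩ => hcne ?_⟩
    have hsurj : Function.Surjective f := by
      intro v
      have : v ∈ ((⊤ : (c.2.out).Subgraph).map f).verts := by rw [hf]; trivial
      obtain ⟨x, -, rfl⟩ := this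
      exact ⟨x, rfl⟩
    have hadj : ∀ u v, F.Adj u v → ∃ x y, c.2.out.Adj x y ∧ f x = u ∧ f y = v := by
      intro u v huv
      have : ((⊤ : (c.2.out).Subgraph).map f).Adj u v := by rw [hf]; exact huv
      obtain ⟨x, y, hxy, rfl, rfl⟩ := this
      exact ⟨x, y, hxy, rfl, rfl⟩
    have hle : c.1 ≤ c0.1 := hmax c hc
    have hge : c0.1 ≤ c.1 := by
      simpa using Fintype.card_le_of_surjective f hsurj
    obtain ⟨n, c⟩ := c
    obtain ⟨m, c0⟩ := c0
    obtain rfl : n = m := le_antisymm hle hge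
    have hinj : Function.Injective f := Finite.injective_iff_surjective.mpr hsurj
    congr 1
    rw [← Quotient.out_equiv_out]
    refine ⟨⟨Equiv.ofBijective f ⟨hinj, hsurj⟩, ?_⟩⟩
    intro x y
    constructor
    · intro hxy
      obtain ⟨x', y', hxy', hx, hy⟩ := hadj _ _ hxy
      rwa [hinj hx, hinj hy] at hxy'
    · intro hxy
      exact f.map_rel hxy
  · intro hh; exact absurd hc0 hh

noncomputable def injCount {n : ℕ} (H : SimpleGraph (Fin n)) {V : Type} (G : SimpleGraph V) : ℕ :=
  Nat.card {f : H →g G // Function.Injective f}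

/-- quotient graph transported to `Fin m` -/
def quoGraph {n m : ℕ} (H : SimpleGraph (Fin n)) (q : Fin n → Fin m) : SimpleGraph (Fin m) where
  Adj a b := a ≠ b ∧ ∃ x y, q x = a ∧ q y = b ∧ H.Adj x y
  symm := ⟨fun a b => by
    rintro ⟨h, x, y, hx, hy, hxy⟩
    exact ⟨h.symm, y, x, hy, hx, hxy.symm⟩⟩
  loopless := ⟨fun a h => h.1 rfl⟩

lemma injExp (n : ℕ) : ∀ H : SimpleGraph (Fin n), ∃ b : GC →₀ ℚ, (∀ c : GC, n ≤ c.1 → b c = 0) ∧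
    ∀ (V : Type) [Fintype V] (G : SimpleGraph V),
      (injCount H G : ℚ) = homCount H G + hev b G := by
  classical
  induction n using Nat.strong_induction_on with
  | _ n ih =>
  intro H
  have key : ∀ s : Setoid (Fin n), s ≠ ⊥ → ∃ b : GC →₀ ℚ, (∀ c : GC, n ≤ c.1 → b c = 0) ∧
      ∀ (V : Type) [Fintype V] (G : SimpleGraph V),
      (Nat.card {f : H →g G // Setoid.ker f = s} : ℚ) = hev b G := by
    intro s hs
    by_cases hedge : ∃ x y, H.Adj x y ∧ s x y
    · refine ⟨0, by simp, ?_⟩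
      intro V _ G
      obtain ⟨x, y, hxy, hsxy⟩ := hedge
      have : Nat.card {f : H →g G // Setoid.ker f = s} = 0 := by
        rw [Nat.card_eq_zero]
        left
        refine ⟨fun ⟨f, hf⟩ => ?_⟩
        rw [← hf] at hsxy
        exact (f.map_rel hxy).ne hsxy
      rw [this]
      simp [hev]
    · push Not at hedge
      let m := Fintype.card (Quotient s)
      let e : Quotient s ≃ Fin m := Fintype.equivFin _
      have hm : m < n := by
        by_contra hcon
        have h2 : Function.Surjective (Quotient.mk s) := Quotient.mk_surjective
        have h3 : Function.Bijective (Quotient.mk s) := by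
          rw [Fintype.bijective_iff_surjective_and_card]
          refine ⟨h2, le_antisymm ?_ ?_⟩
          · simpa [m] using hcon
          · exact Fintype.card_le_of_surjective _ h2
        apply hs
        rw [eq_bot_iff]
        intro x y hxy
        exact h3.1 (Quotient.sound hxy)
      let q : Fin n → Fin m := fun x => e (Quotient.mk s x)
      have hq : ∀ x y, q x = q y ↔ s x y := by
        intro x y
        simp only [q, e.injective.eq_iff]
        exact Quotient.eq
      have hqs : Function.Surjective q := e.surjective.comp Quotient.mk_surjective
      obtain ⟨b, hb0, hb⟩ := ih m hm (quoGraph H q)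
      refine ⟨Finsupp.single ⟨m, ⟦quoGraph H q⟧⟩ 1 + b, ?_, ?_⟩
      · intro c hc
        rw [Finsupp.add_apply, hb0 c (by omega), Finsupp.single_apply, if_neg, add_zero]
        rintro rfl
        simp only at hc
        omega
      · intro V _ G
        rw [hev_add, hev_single, ← hb]
        unfold injCount
        congr 1
        symm
        refine Nat.card_congr (Equiv.ofBijective (fun g => ⟨⟨fun x => g.1 (q x), ?_⟩, ?_⟩) ?_)
        · intro x y hxy
          apply g.1.map_rel
          refine ⟨?_, x, y, rfl, rfl, hxy⟩
          intro hh
          exact hedge x y hxy ((hq x y).1 hh)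
        · ext x y
          rw [Setoid.ker_def, ← hq]
          exact g.2.eq_iff
        · constructor
          · intro g g' hgg
            ext a
            obtain ⟨x, rfl⟩ := hqs a
            have := congrArg (fun f => f.1 x) hgg
            exact this
          · rintro ⟨f, hf⟩
            have hff : ∀ x y, f x = f y ↔ q x = q y := by
              intro x y
              rw [hq, ← hf]; rfl
            have hr := Function.rightInverse_surjInv hqs
            refine ⟨⟨⟨fun a => f (Function.surjInv hqs a), ?_⟩, ?_⟩, ?_⟩
            · rintro a b ⟨-, x, y, rfl, rfl, hxy⟩
              have h1 : f (Function.surjInv hqs (q x)) = f x := (hff _ _).2 (hr _)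
              have h2 : f (Function.surjInv hqs (q y)) = f y := (hff _ _).2 (hr _)
              rw [h1, h2]
              exact f.map_rel hxy
            · intro a b hab
              have := (hff _ _).1 hab
              rwa [hr, hr] at this
            · ext x
              exact (hff _ _).2 (hr _)
  choose! B hB0 hB using key
  have : Finite (Setoid (Fin n)) :=
    Finite.of_injective (fun s : Setoid (Fin n) => (s.r : Fin n → Fin n → Prop)) (by
      intro s t hst
      ext x y
      exact iff_of_eq (congrFun (congrFun hst x) y))
  let _ : Fintype (Setoid (Fin n)) := Fintype.ofFinite _
  refine ⟨(-1 : ℚ) • ∑ s ∈ Finset.univ.erase ⊥, B s, ?_, ?_⟩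
  · intro c hc
    rw [Finsupp.smul_apply, Finsupp.finsetSum_apply, Finset.sum_eq_zero, smul_zero]
    intro s hs
    exact hB0 s (Finset.ne_of_mem_erase hs) c hc
  · intro V _ G
    have h1 : homCount H G = ∑ s : Setoid (Fin n), Nat.card {f : H →g G // Setoid.ker f = s} := by
      unfold homCount
      rw [← Nat.card_congr (Equiv.sigmaFiberEquiv (fun f : H →g G => Setoid.ker f)),
        Nat.card_sigma]
    have h2 : injCount H G = Nat.card {f : H →g G // Setoid.ker f = ⊥} := by
      unfold injCount
      refine Nat.card_congr (Equiv.subtypeEquivRight fun f => ?_)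
      exact Setoid.injective_iff_ker_bot f
    rw [hev_smul, hev_sum, h1, h2, ← Finset.add_sum_erase _ _ (Finset.mem_univ ⊥)]
    push_cast
    rw [Finset.sum_congr rfl fun s hs => hB s (Finset.ne_of_mem_erase hs) V G]
    ring

lemma exists_mobius {P : Type*} [PartialOrder P] [Fintype P] [DecidableLE P] (g : P → ℚ) :
    ∃ c : P → ℚ, ∀ L, ∑ K ∈ Finset.univ.filter (· ≤ L), c K = g L := by
  let T : (P → ℚ) →ₗ[ℚ] (P → ℚ) :=
    { toFun := fun c L => ∑ K ∈ Finset.univ.filter (· ≤ L), c K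
      map_add' := by intro c c'; ext L; simp [Finset.sum_add_distrib]
      map_smul' := by intro r c; ext L; simp [Finset.mul_sum] }
  have hT : Function.Injective T := by
    rw [injective_iff_map_eq_zero]
    intro c hc
    ext L
    induction L using WellFoundedLT.induction with
    | ind L ih =>
      have : ∑ K ∈ Finset.univ.filter (· ≤ L), c K = 0 := congrFun hc L
      rw [Finset.sum_eq_single L] at this
      · exact this
      · intro b hb hbne
        exact ih b (lt_of_le_of_ne (by simpa using hb) hbne)
      · intro hh; simp at hh
  obtain ⟨c, hc⟩ := (LinearMap.injective_iff_surjective.mp hT) g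
  exact ⟨c, fun L => congrFun hc L⟩

lemma indSub_count (Φ : GraphProperty) (hΦ : Invariant Φ) (k : ℕ) {V : Type} [Fintype V]
    (G : SimpleGraph V) :
    Nat.card {φ : Fin k ↪ V // Φ k (G.comap φ)} = indSub Φ k G * k.factorial := by
  classical
  unfold indSub
  set I := {S : Finset V // S.card = k ∧
    ∃ e : Fin k ≃ (S : Set V), Φ k ((G.induce (S : Set V)).comap e)} with hI
  have h1 : Nat.card (Σ S : I, (Fin k ≃ (S.1 : Set V))) = Nat.card I * k.factorial := by
    rw [Nat.card_sigma, Finset.sum_congr rfl (g := fun _ => k.factorial)]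
    · simp
    · rintro ⟨S, hS, e, he⟩ -
      rw [Nat.card_eq_fintype_card, Fintype.card_equiv e, Fintype.card_fin]
  rw [← h1]
  symm
  refine Nat.card_congr (Equiv.ofBijective
    (fun p => ⟨p.2.toEmbedding.trans (Function.Embedding.subtype _), ?_⟩) ?_)
  · obtain ⟨⟨S, hS, e, he⟩, e'⟩ := p
    refine (hΦ k _ _ ⟨?_⟩).1 he
    exact ⟨e.trans e'.symm, by intro x y; simp⟩
  · constructor
    · rintro ⟨⟨S, hS⟩, e⟩ ⟨⟨S', hS'⟩, e'⟩ h
      have h0 : ∀ x, (e x : V) = e' x := by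
        intro x
        exact congrArg (fun f => f.1 x) h
      obtain rfl : S = S' := by
        ext v
        constructor
        · intro hv
          have := h0 (e.symm ⟨v, hv⟩)
          simp only [Equiv.apply_symm_apply] at this
          rw [this]
          exact (e' _).2
        · intro hv
          have := h0 (e'.symm ⟨v, hv⟩)
          simp only [Equiv.apply_symm_apply] at this
          rw [← this]
          exact (e _).2
      congr 1
      ext x
      exact h0 x
    · rintro ⟨φ, hφ⟩
      let S : Finset V := Finset.univ.map φ
      have hmem : ∀ x, φ x ∈ (S : Set V) := by intro x; simp [S]
      let e : Fin k ≃ (S : Set V) := Equiv.ofBijective (fun x => ⟨φ x, hmem x⟩) (by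
        constructor
        · intro x y hxy
          exact φ.injective (congrArg Subtype.val hxy)
        · rintro ⟨v, hv⟩
          have : v ∈ S := hv
          simp only [S, Finset.mem_map, Finset.mem_univ, true_and] at this
          obtain ⟨x, rfl⟩ := this
          exact ⟨x, rfl⟩)
      exact ⟨⟨⟨S, by simp [S], e, hφ⟩, e⟩, rfl⟩

lemma emb_count {k : ℕ} (Φ : GraphProperty) (c : SimpleGraph (Fin k) → ℚ)
    [Fintype (SimpleGraph (Fin k))] [DecidableLE (SimpleGraph (Fin k))]
    [DecidablePred (Φ k)]
    (hc : ∀ L, ∑ K ∈ Finset.univ.filter (· ≤ L), c K = if Φ k L then 1 else 0)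
    {V : Type} [Fintype V] (G : SimpleGraph V) :
    (Nat.card {φ : Fin k ↪ V // Φ k (G.comap φ)} : ℚ) = ∑ K, c K * injCount K G := by
  classical
  have h1 : ∀ K : SimpleGraph (Fin k), injCount K G
      = (Finset.univ.filter fun φ : Fin k ↪ V => K ≤ G.comap φ).card := by
    intro K
    unfold injCount
    rw [← Fintype.card_subtype, ← Nat.card_eq_fintype_card]
    refine Nat.card_congr ⟨fun f => ⟨⟨f.1, f.2⟩, fun x y h => f.1.map_rel h⟩,
      fun φ => ⟨⟨φ.1, fun {x y} h => φ.2 h⟩, φ.1.injective⟩, ?_, ?_⟩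
    · intro f; rfl
    · intro f; rfl
  rw [Nat.card_eq_fintype_card, Fintype.card_subtype, Finset.card_filter]
  push_cast
  simp_rw [← hc, h1, Finset.card_filter, Finset.sum_filter]
  rw [Finset.sum_comm]
  refine Finset.sum_congr rfl fun K _ => ?_
  push_cast
  rw [Finset.mul_sum]
  simp

lemma above_count {k : ℕ} [Fintype (SimpleGraph (Fin k))] [DecidableLE (SimpleGraph (Fin k))]
    (K : SimpleGraph (Fin k)) (i : ℕ) :
    (Finset.univ.filter fun L : SimpleGraph (Fin k) => K ≤ L ∧ edgeCount L = i).card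
      * (k * (k - 1) / 2).descFactorial (edgeCount K)
      = (k * (k - 1) / 2).choose i * i.descFactorial (edgeCount K) := by
  classical
  set d := k * (k - 1) / 2 with hd
  have hE : ∀ L : SimpleGraph (Fin k), edgeCount L = L.edgeFinset.card := by
    intro L
    unfold edgeCount
    rw [Nat.card_eq_fintype_card, edgeFinset_card]
  have htop : (⊤ : SimpleGraph (Fin k)).edgeFinset.card = d := by
    rw [card_edgeFinset_top_eq_card_choose_two, Fintype.card_fin, Nat.choose_two_right]
  have hsub : ∀ L : SimpleGraph (Fin k), L.edgeFinset ⊆ (⊤ : SimpleGraph (Fin k)).edgeFinset :=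
    fun L => edgeFinset_subset_edgeFinset.2 le_top
  by_cases hai : edgeCount K ≤ i
  · have hcard : (Finset.univ.filter fun L : SimpleGraph (Fin k) => K ≤ L ∧ edgeCount L = i).card
        = (d - edgeCount K).choose (i - edgeCount K) := by
      have h2 : ((⊤ : SimpleGraph (Fin k)).edgeFinset \ K.edgeFinset).card = d - edgeCount K := by
        rw [Finset.card_sdiff_of_subset (hsub K), htop, hE]
      rw [← h2, ← Finset.card_powersetCard]
      have hfe : ∀ C ∈ Finset.powersetCard (i - edgeCount K)
          ((⊤ : SimpleGraph (Fin k)).edgeFinset \ K.edgeFinset),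
          ∀ [Fintype (fromEdgeSet ((C ∪ K.edgeFinset : Finset _) : Set (Sym2 (Fin k)))).edgeSet],
          (fromEdgeSet ((C ∪ K.edgeFinset : Finset _) : Set (Sym2 (Fin k)))).edgeFinset
            = C ∪ K.edgeFinset := by
        intro C hC _
        rw [Finset.mem_powersetCard] at hC
        apply Finset.coe_injective
        rw [coe_edgeFinset, edgeSet_fromEdgeSet, sdiff_eq_left, Set.disjoint_left]
        intro e he hdiag
        have : e ∈ (⊤ : SimpleGraph (Fin k)).edgeFinset := by
          rcases Finset.mem_union.1 (Finset.mem_coe.1 he) with h | h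
          · exact (Finset.mem_sdiff.1 (hC.1 h)).1
          · exact hsub K h
        exact not_isDiag_of_mem_edgeFinset this hdiag
      refine Finset.card_bij' (fun L _ => L.edgeFinset \ K.edgeFinset)
        (fun C _ => fromEdgeSet ((C ∪ K.edgeFinset : Finset _) : Set (Sym2 (Fin k)))) ?_ ?_ ?_ ?_
      · intro L hL
        simp only [Finset.mem_filter, Finset.mem_univ, true_and] at hL
        rw [Finset.mem_powersetCard]
        refine ⟨Finset.sdiff_subset_sdiff (hsub L) le_rfl, ?_⟩
        rw [Finset.card_sdiff_of_subset (edgeFinset_subset_edgeFinset.2 hL.1), ← hE, ← hE, hL.2]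
      · intro C hC
        simp only [Finset.mem_filter, Finset.mem_univ, true_and]
        constructor
        · rw [← edgeFinset_subset_edgeFinset, hfe C hC]
          exact Finset.subset_union_right
        · rw [hE]
          trans (C ∪ K.edgeFinset).card
          · refine congrArg Finset.card ?_
            convert hfe C hC
          rw [Finset.mem_powersetCard] at hC
          rw [Finset.card_union_of_disjoint, hC.2, ← hE]
          · omega
          · exact Finset.disjoint_of_subset_left hC.1 Finset.sdiff_disjoint
      · intro L hL
        simp only [Finset.mem_filter, Finset.mem_univ, true_and] at hL
        rw [Finset.sdiff_union_of_subset (edgeFinset_subset_edgeFinset.2 hL.1), coe_edgeFinset,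
          fromEdgeSet_edgeSet]
      · intro C hC
        trans (C ∪ K.edgeFinset) \ K.edgeFinset
        · refine congrArg (fun X => X \ K.edgeFinset) ?_
          convert hfe C hC
        rw [Finset.mem_powersetCard] at hC
        rw [Finset.union_sdiff_right, Finset.sdiff_eq_self_iff_disjoint]
        exact Finset.disjoint_of_subset_left hC.1 Finset.sdiff_disjoint
    rw [hcard]
    by_cases hid : i ≤ d
    · have := Nat.choose_mul (n := d) hai
      rw [Nat.descFactorial_eq_factorial_mul_choose, Nat.descFactorial_eq_factorial_mul_choose]
      rw [mul_left_comm, mul_comm ((d - edgeCount K).choose _), ← this]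
      ring
    · rw [Nat.choose_eq_zero_of_lt (show d < i by omega), Nat.choose_eq_zero_of_lt]
      · simp
      · have := Finset.card_le_card (hsub K)
        rw [htop, ← hE] at this
        omega
  · rw [Finset.filter_false_of_mem]
    · rw [Nat.descFactorial_eq_zero_iff_lt.2 (show i < edgeCount K by omega)]
      simp
    · rintro L - ⟨hKL, hL⟩
      have := Finset.card_le_card (edgeFinset_subset_edgeFinset.2 hKL)
      rw [← hE, ← hE] at this
      omega

lemma edgeCount_le {k : ℕ} (K : SimpleGraph (Fin k)) : edgeCount K ≤ k * (k - 1) / 2 := by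
  classical
  unfold edgeCount
  rw [Nat.card_eq_fintype_card, ← edgeFinset_card]
  have := Finset.card_le_card (edgeFinset_subset_edgeFinset.2 (le_top : K ≤ ⊤))
  rwa [card_edgeFinset_top_eq_card_choose_two, Fintype.card_fin, Nat.choose_two_right] at this

lemma edgeCount_out {k : ℕ} (K : SimpleGraph (Fin k)) :
    edgeCount (⟦K⟧ : GraphClass k).out = edgeCount K := by
  obtain ⟨e⟩ : Nonempty ((⟦K⟧ : GraphClass k).out ≃g K) := Quotient.mk_out K
  exact Nat.card_congr e.mapEdgeSet

lemma fVec_eq {k : ℕ} (Φ : GraphProperty) (c : SimpleGraph (Fin k) → ℚ)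
    [Fintype (SimpleGraph (Fin k))] [DecidableLE (SimpleGraph (Fin k))]
    [DecidablePred (Φ k)]
    (hc : ∀ L, ∑ K ∈ Finset.univ.filter (· ≤ L), c K = if Φ k L then 1 else 0) (i : ℕ) :
    (fVec Φ k i : ℚ) = ∑ K, c K *
      (((k * (k - 1) / 2).choose i * i.descFactorial (edgeCount K) : ℕ) : ℚ)
        / ((k * (k - 1) / 2).descFactorial (edgeCount K) : ℕ) := by
  classical
  have h1 : ∀ K : SimpleGraph (Fin k),
      (((k * (k - 1) / 2).choose i * i.descFactorial (edgeCount K) : ℕ) : ℚ)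
        / ((k * (k - 1) / 2).descFactorial (edgeCount K) : ℕ)
      = (Finset.univ.filter fun L : SimpleGraph (Fin k) => K ≤ L ∧ edgeCount L = i).card := by
    intro K
    rw [← above_count]
    push_cast
    rw [mul_div_cancel_right₀]
    rw [Nat.cast_ne_zero, ne_eq, Nat.descFactorial_eq_zero_iff_lt]
    exact not_lt.2 (edgeCount_le K)
  unfold fVec
  simp_rw [mul_div_assoc, h1]
  rw [Nat.card_eq_fintype_card, Fintype.card_subtype, Finset.card_filter]
  have h2 : ∀ L, (((if edgeCount L = i ∧ Φ k L then 1 else 0 : ℕ)) : ℚ)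
      = ∑ K, if K ≤ L ∧ edgeCount L = i then c K else 0 := by
    intro L
    by_cases hL : edgeCount L = i
    · have := hc L
      rw [Finset.sum_filter] at this
      simp only [hL, true_and, and_true, this]
      push_cast
      rfl
    · simp [hL]
  rw [Nat.cast_sum]
  simp_rw [h2, Finset.card_filter]
  rw [Finset.sum_comm]
  refine Finset.sum_congr rfl fun K _ => ?_
  push_cast
  rw [Finset.mul_sum]
  simp

lemma hev_finsum (a : GC → ℚ) (ha : (Function.support a).Finite) {V : Type} [Fintype V]
    (G : SimpleGraph V) :
    ∑ᶠ c : GC, a c * (classHomCount c.2 G : ℚ) = hev (Finsupp.ofSupportFinite a ha) G := by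
  rw [finsum_eq_sum_of_support_subset (s := ha.toFinset)]
  · rfl
  · intro c hc
    simp only [Set.Finite.coe_toFinset, Function.mem_support] at *
    exact left_ne_zero_of_mul hc

lemma exists_expansion (Φ : GraphProperty) (hΦ : Invariant Φ) (k : ℕ)
    (hnt : ∃ H : SimpleGraph (Fin k), Φ k H) :
    ∃ a : GC →₀ ℚ, (∀ (V : Type) [Fintype V] (G : SimpleGraph V), (indSub Φ k G : ℚ) = hev a G) ∧
      ∃ K : SimpleGraph (Fin k),
        ((k * (k - 1) / 2 : ℕ) : ℤ) - (hammingWeight Φ k : ℤ) + 1 ≤ (edgeCount K : ℤ) ∧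
        a ⟨k, ⟦K⟧⟩ ≠ 0 := by
  classical
  obtain ⟨c, hc⟩ := exists_mobius (P := SimpleGraph (Fin k)) (fun L => if Φ k L then 1 else 0)
  choose b hb0 hb using injExp k
  have hk0 : (k.factorial : ℚ) ≠ 0 := by exact_mod_cast k.factorial_ne_zero
  let a : GC →₀ ℚ := (1 / (k.factorial : ℚ)) •
    ∑ K : SimpleGraph (Fin k), c K • (Finsupp.single ⟨k, ⟦K⟧⟩ 1 + b K)
  refine ⟨a, ?_, ?_⟩
  · intro V _ G
    have h1 := indSub_count Φ hΦ k G
    have h2 := emb_count Φ c hc G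
    rw [h1] at h2
    simp only [a]
    rw [hev_smul, hev_sum]
    simp_rw [hev_smul, hev_add, hev_single, ← hb]
    rw [← h2]
    push_cast
    field_simp
  · set d := k * (k - 1) / 2 with hd
    set w := hammingWeight Φ k with hw
    have ha : ∀ κ : GraphClass k, (k.factorial : ℚ) * a ⟨k, κ⟩
        = ∑ K ∈ Finset.univ.filter (fun K : SimpleGraph (Fin k) => (⟦K⟧ : GraphClass k) = κ),
          c K := by
      intro κ
      simp only [a, Finsupp.smul_apply, Finsupp.finsetSum_apply, Finsupp.add_apply, smul_eq_mul]
      rw [← mul_assoc, mul_one_div_cancel hk0, one_mul, Finset.sum_filter]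
      refine Finset.sum_congr rfl fun K _ => ?_
      rw [hb0 K _ le_rfl, Finsupp.single_apply]
      simp
    by_contra hcon
    push Not at hcon
    let p : Polynomial ℚ := ∑ κ : GraphClass k,
      Polynomial.C ((k.factorial : ℚ) * a ⟨k, κ⟩ / (d.descFactorial (edgeCount κ.out) : ℕ))
        * descPochhammer ℚ (edgeCount κ.out)
    have hp : ∀ i : ℕ, (fVec Φ k i : ℚ) = d.choose i * p.eval (i : ℚ) := by
      intro i
      rw [fVec_eq Φ c hc i, ← Finset.sum_fiberwise (s := Finset.univ)
        (g := fun K : SimpleGraph (Fin k) => (⟦K⟧ : GraphClass k))]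
      simp only [p, Polynomial.eval_finsetSum, Polynomial.eval_mul, Polynomial.eval_C,
        descPochhammer_eval_eq_descFactorial]
      rw [Finset.mul_sum]
      refine Finset.sum_congr rfl fun κ _ => ?_
      rw [ha, div_mul_eq_mul_div, mul_div_assoc', Finset.sum_mul, Finset.mul_sum, Finset.sum_div]
      refine Finset.sum_congr rfl fun K hK => ?_
      rw [Finset.mem_filter] at hK
      rw [← hK.2, edgeCount_out]
      push_cast
      ring
    let s : Finset ℕ := (Finset.range (d + 1)).filter (fun i => ¬ fVec Φ k i ≠ 0)
    have hs : w + s.card = d + 1 := by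
      have := Finset.card_filter_add_card_filter_not (s := Finset.range (d + 1))
        (fun i => fVec Φ k i ≠ 0)
      rw [Finset.card_range] at this
      exact this
    have hdeg : p.degree < (s.card : ℕ) := by
      rw [← Polynomial.mem_degreeLT]
      refine Submodule.sum_mem _ fun κ _ => ?_
      by_cases h0 : a ⟨k, κ⟩ = 0
      · simp [h0]
      · rw [Polynomial.mem_degreeLT]
        rw [← Polynomial.smul_eq_C_mul]
        refine lt_of_le_of_lt (Polynomial.degree_smul_le _ _) ?_
        refine lt_of_le_of_lt Polynomial.degree_le_natDegree ?_
        rw [descPochhammer_natDegree]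
        have := mt (hcon κ.out) (by rwa [Quotient.out_eq])
        norm_cast
        omega
    have hp0 : p = 0 := by
      have hcast : (s.image (fun i : ℕ => (i : ℚ))).card = s.card :=
        Finset.card_image_of_injective _ Nat.cast_injective
      refine Polynomial.eq_zero_of_degree_lt_of_eval_finset_eq_zero
        (s.image (fun i : ℕ => (i : ℚ))) (by rw [hcast]; exact hdeg) ?_
      intro x hx
      obtain ⟨i, hi, rfl⟩ := Finset.mem_image.1 hx
      simp only [s, Finset.mem_filter, Finset.mem_range, not_not] at hi
      have h1 := hp i
      rw [hi.2, Nat.cast_zero, zero_eq_mul] at h1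
      refine h1.resolve_left ?_
      rw [← ne_eq, Nat.cast_ne_zero]
      exact (Nat.choose_pos (by omega)).ne'
    obtain ⟨H, hH⟩ := hnt
    have h1 := hp (edgeCount H)
    rw [hp0, Polynomial.eval_zero, mul_zero, Nat.cast_eq_zero] at h1
    unfold fVec at h1
    rw [Nat.card_eq_zero] at h1
    rcases h1 with h1 | h1
    · exact h1.false ⟨H, rfl, hH⟩
    · exact h1.not_finite inferInstance

/-- If `Φ` is not trivially false on `k`-vertex graphs, then the unique finitely
supported coefficient function `a` in the homomorphism expansion of `#IndSub(Φ,k,·)`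
is nonzero on some graph `K` on `k` vertices with at least `k(k−1)/2 − w + 1` edges. -/
theorem stmt11 (Φ : GraphProperty) (hΦ : Invariant Φ) (k : ℕ) (hk : 0 < k)
    (hnt : ∃ H : SimpleGraph (Fin k), Φ k H) :
    (∃! a : (Σ n, GraphClass n) → ℚ,
      (Function.support a).Finite ∧
      ∀ (V : Type) [Fintype V], ∀ G : SimpleGraph V,
        (indSub Φ k G : ℚ) = ∑ᶠ c : Σ n, GraphClass n, a c * (classHomCount c.2 G : ℚ)) ∧
    ∀ a : (Σ n, GraphClass n) → ℚ,
      (Function.support a).Finite →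
      (∀ (V : Type) [Fintype V], ∀ G : SimpleGraph V,
        (indSub Φ k G : ℚ) = ∑ᶠ c : Σ n, GraphClass n, a c * (classHomCount c.2 G : ℚ)) →
      ∃ K : SimpleGraph (Fin k),
        ((k * (k - 1) / 2 : ℕ) : ℤ) - (hammingWeight Φ k : ℤ) + 1 ≤ (edgeCount K : ℤ) ∧
        a ⟨k, ⟦K⟧⟩ ≠ 0 := by
  obtain ⟨a0, h0, K, hK, haK⟩ := exists_expansion Φ hΦ k hnt
  have huniq : ∀ a : GC → ℚ, (Function.support a).Finite →
      (∀ (V : Type) [Fintype V], ∀ G : SimpleGraph V,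
        (indSub Φ k G : ℚ) = ∑ᶠ c : GC, a c * (classHomCount c.2 G : ℚ)) → a = a0 := by
    intro a ha h
    have h1 : Finsupp.ofSupportFinite a ha - a0 = 0 := by
      apply hev_inj
      intro V _ G
      rw [hev_sub, ← hev_finsum, ← h, h0, sub_self]
    rw [← sub_eq_zero.1 h1]
    rfl
  refine ⟨⟨a0, ⟨a0.hasFiniteSupport, ?_⟩, fun a ha => huniq a ha.1 ha.2⟩, ?_⟩
  · intro V _ G
    rw [h0, hev_finsum a0 a0.hasFiniteSupport]
    congr 1
    ext c
    rfl
  · intro a ha h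
    refine ⟨K, hK, ?_⟩
    rw [huniq a ha h]
    exact haK
end
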